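/- Let Ω = ℂ∖[0,∞) and let η : Ω → ℂ∖{0} be an analytic function satisfying η(conj z) = conj(η(z)) for all z ∈ Ω. Then the following are equivalent: (1) there exists a Borel probability measure μ on [0,∞) with μ ≠ δ₀ such that η = η_μ on Ω; (2) η(x) → 0 as x → 0 along the negative real axis, and for every z in the upper half-plane the principal argument of η(z) lies in the interval [arg z, π). -/

import Mathlib

open MeasureTheory Filter

/-- Ω = ℂ ∖ [0,∞) -/
def OmegaR : Set ℂ := {z : ℂ | ¬ (z.im = 0 ∧ 0 ≤ z.re)}

/-- ψ-transform of a measure on [0,∞) (viewed as a measure on ℝ). -/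
noncomputable def psiR (μ : Measure ℝ) (z : ℂ) : ℂ :=
  ∫ s : ℝ, z * (s : ℂ) / (1 - z * (s : ℂ)) ∂μ

/-- η-transform of a measure on [0,∞). -/
noncomputable def etaR (μ : Measure ℝ) (z : ℂ) : ℂ :=
  psiR μ z / (1 + psiR μ z)

noncomputable def KK (v : ℂ) (c : ℝ) : ℂ := (1 - v^2) / (1 - 2 * v * c + v^2)

lemma KK_den {v : ℂ} (hv : ‖v‖ < 1) {c : ℝ} (hc : c ∈ Set.Icc (-1:ℝ) 1) :
    1 - 2 * v * c + v^2 ≠ 0 := by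
  intro h
  have h1 := congrArg Complex.re h
  have h2 := congrArg Complex.im h
  simp [pow_two] at h1 h2
  have h3 : v.re^2 + v.im^2 < 1 := by
    have : ‖v‖^2 < 1 := by nlinarith [norm_nonneg v]
    rw [← Complex.normSq_eq_norm_sq, Complex.normSq_apply] at this
    nlinarith
  obtain ⟨ha, hb⟩ := hc
  have h4 : v.im * (v.re - c) = 0 := by nlinarith
  rcases mul_eq_zero.1 h4 with h5 | h5
  · rw [h5] at h1 h3
    have h6 : (v.re - c)^2 = c^2 - 1 := by nlinarith
    have h7 : c^2 ≤ 1 := by nlinarith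
    have h8 : (v.re - c)^2 = 0 := le_antisymm (by linarith) (sq_nonneg _)
    have h9 : v.re = c := by linarith [pow_eq_zero_iff (two_ne_zero) |>.1 h8]
    rw [h9] at h3; nlinarith
  · have : c = v.re := by linarith
    subst this
    nlinarith

lemma KK_decomp {v : ℂ} (hv : ‖v‖ < 1) {z : ℂ} (hz : ‖z‖ = 1) :
    KK v z.re = z / (z - v) + z * (v / (1 - v * z)) := by
  have hzz : z * (starRingEnd ℂ) z = 1 := by
    rw [Complex.mul_conj, Complex.normSq_eq_norm_sq, hz]; simp
  have hre : (2 * z.re : ℂ) = z + (starRingEnd ℂ) z := by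
    rw [Complex.add_conj]; simp
  have h1 : z - v ≠ 0 := by
    intro h; rw [sub_eq_zero] at h; rw [h] at hz; linarith
  have h2 : 1 - v * z ≠ 0 := by
    intro h; rw [sub_eq_zero] at h
    have := congrArg norm h; simp [hz] at this; linarith
  have h3 := KK_den hv (c := z.re) (abs_le.1 (hz ▸ Complex.abs_re_le_norm z))
  have h0 : z ≠ 0 := by rintro rfl; simp at hz
  have key : (1 - 2 * v * z.re + v^2) * z = (z - v) * (1 - v * z) := by
    linear_combination (-v * z) * hre + (-v) * hzz
  unfold KK
  rw [← mul_div_assoc, div_add_div _ _ h1 h2, div_eq_div_iff h3 (mul_ne_zero h1 h2), ← key]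
  ring

open Metric ComplexConjugate in
lemma L1 (g : ℂ → ℂ) (hg : DiffContOnCl ℂ g (ball 0 1))
    (hsym : ∀ z ∈ closedBall (0:ℂ) 1, g (conj z) = conj (g z)) (v : ℂ) (hv : ‖v‖ < 1) :
    Real.circleAverage (fun z => KK v z.re * ((g z).re:ℂ)) 0 1 = g v := by
  have hgc : ContinuousOn g (sphere 0 |1|) := by
    refine hg.2.mono ?_
    rw [closure_ball _ one_ne_zero, abs_one]
    exact sphere_subset_closedBall
  have hKc : ContinuousOn (fun z : ℂ => KK v z.re) (sphere 0 |1|) := by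
    unfold KK
    refine ContinuousOn.div (by fun_prop) (by fun_prop) ?_
    intro z hz
    have hz : ‖z‖ = 1 := by simpa using hz
    exact KK_den hv (c := z.re) (abs_le.1 (hz ▸ Complex.abs_re_le_norm z))
  have hA : Real.circleAverage (fun z => KK v z.re * g z) 0 1 = g v := by
    have e1 : DiffContOnCl ℂ (fun z => g z + (z - v) * (v / (1 - v * z)) * g z) (ball 0 1) := by
      have hne : ∀ z ∈ closure (ball (0:ℂ) 1), 1 - v * z ≠ 0 := by
        intro z hz h
        rw [closure_ball _ one_ne_zero, mem_closedBall_zero_iff] at hz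
        rw [sub_eq_zero] at h
        have := congrArg norm h; simp at this
        nlinarith [norm_nonneg v, norm_nonneg z]
      have e2 : DiffContOnCl ℂ (fun z => (z - v) * (v / (1 - v * z))) (ball 0 1) := by
        refine ⟨?_, ?_⟩
        · intro z hz
          have := hne z (subset_closure hz)
          refine DifferentiableAt.differentiableWithinAt ?_
          fun_prop (disch := assumption)
        · exact ContinuousOn.mul (by fun_prop) (ContinuousOn.div (by fun_prop) (by fun_prop) hne)
      exact hg.add (e2.smul hg)
    have e3 := DiffContOnCl.circleAverage_smul_div (c := 0) (R := 1) (w := v) (by simpa using e1) (by simpa using hv)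
    simp only [sub_self, zero_mul, add_zero] at e3
    rw [← e3]
    refine Real.circleAverage_congr_sphere ?_
    intro z hz
    have hz : ‖z‖ = 1 := by simpa using hz
    have h1 : z - v ≠ 0 := by
      intro h; rw [sub_eq_zero] at h; rw [h] at hz; linarith
    simp only [KK_decomp hv hz, smul_eq_mul, sub_zero]
    field_simp
  have hB : Real.circleAverage (fun z => KK v z.re * conj (g z)) 0 1 = g v := by
    rw [← Real.circleAverage_zero_one_congr_inv, ← hA]
    refine Real.circleAverage_congr_sphere ?_
    intro z hz
    have hz : ‖z‖ = 1 := by simpa using hz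
    have : z⁻¹ = conj z := by
      rw [Complex.inv_def, Complex.normSq_eq_norm_sq, hz]; simp
    simp only [this, Complex.conj_re]
    rw [hsym z (by simp [hz])]; simp
  have : (fun z => KK v z.re * ((g z).re:ℂ)) = (2:ℂ)⁻¹ • ((fun z => KK v z.re * g z) + (fun z => KK v z.re * conj (g z))) := by
    ext z
    have hre : (2 * (g z).re : ℂ) = g z + (starRingEnd ℂ) (g z) := by
      rw [Complex.add_conj]; simp
    simp only [Pi.smul_apply, Pi.add_apply, smul_eq_mul]
    linear_combination (2:ℂ)⁻¹ * KK v z.re * hre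
  rw [this, Real.circleAverage_smul, Real.circleAverage_add, hA, hB]
  · simp; ring
  · exact (hKc.mul hgc).circleIntegrable'
  · exact (hKc.mul (Complex.continuous_conj.comp_continuousOn hgc)).circleIntegrable'

abbrev XX := Set.Icc (-1:ℝ) 1

noncomputable def cosX (θ : ℝ) : XX := ⟨Real.cos θ, Real.neg_one_le_cos θ, Real.cos_le_one θ⟩

lemma cosX_cont : Continuous cosX := by unfold cosX; fun_prop

lemma LM (ρ : ℝ → ℝ) (hc : Continuous ρ) (hpos : ∀ θ, 0 ≤ ρ θ)
    (hrho : ∫ θ in (0:ℝ)..2 * Real.pi, ρ θ = 1) :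
    ∃ ν : ProbabilityMeasure XX, ∀ f : XX → ℂ, Continuous f →
      ∫ c, f c ∂(ν : Measure XX) = ∫ θ in (0:ℝ)..2 * Real.pi, (ρ θ : ℂ) * f (cosX θ) := by
  have h2pi : (0:ℝ) ≤ 2 * Real.pi := by positivity
  set m := (volume.restrict (Set.Ioc 0 (2 * Real.pi))).withDensity (fun θ => ENNReal.ofReal (ρ θ)) with hm
  have hmp : IsProbabilityMeasure m := by
    constructor
    rw [hm, withDensity_apply _ MeasurableSet.univ, setLIntegral_univ,
      ← ofReal_integral_eq_lintegral_ofReal, ← intervalIntegral.integral_of_le h2pi, hrho]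
    · simp
    · exact (hc.integrableOn_Icc).mono_set Set.Ioc_subset_Icc_self
    · exact Eventually.of_forall hpos
  refine ⟨⟨m.map cosX, Measure.isProbabilityMeasure_map cosX_cont.aemeasurable⟩, ?_⟩
  intro f hf
  simp only [ProbabilityMeasure.coe_mk]
  rw [integral_map cosX_cont.aemeasurable hf.aestronglyMeasurable, hm,
    integral_withDensity_eq_integral_toReal_smul (by fun_prop) (by simp),
    intervalIntegral.integral_of_le h2pi]
  refine integral_congr_ae (Eventually.of_forall ?_)
  intro θ
  simp [ENNReal.toReal_ofReal (hpos θ)]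

open Metric ComplexConjugate in
lemma L2 (h : ℂ → ℂ) (hd : DifferentiableOn ℂ h (ball 0 1))
    (hsym : ∀ z ∈ ball (0:ℂ) 1, h (conj z) = conj (h z))
    (hpos : ∀ z ∈ ball (0:ℂ) 1, 0 < (h z).re) :
    ∃ σ : ProbabilityMeasure XX, ∀ v ∈ ball (0:ℂ) 1,
      h v = h 0 * ∫ c, KK v (c : ℝ) ∂(σ : Measure XX) := by
  have h0 : h 0 = ((h 0).re : ℂ) := by
    have := hsym 0 (by simp)
    simp only [map_zero] at this
    exact (Complex.conj_eq_iff_re.1 this.symm).symm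
  have hp0 := hpos 0 (by simp)
  have hkc : ∀ v ∈ ball (0:ℂ) 1, Continuous (fun c : XX => KK v (c:ℝ)) := by
    intro v hv
    unfold KK
    refine Continuous.div (by fun_prop) (by fun_prop) ?_
    intro c
    exact KK_den (by simpa using hv) c.2
  have step : ∀ r : ℝ, 0 < r → r < 1 → ∃ ν : ProbabilityMeasure XX, ∀ v ∈ ball (0:ℂ) 1,
      h (r * v) = h 0 * ∫ c, KK v (c : ℝ) ∂(ν : Measure XX) := by
    intro r hr hr1
    have hmem : ∀ z ∈ closedBall (0:ℂ) 1, (r:ℂ) * z ∈ ball (0:ℂ) 1 := by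
      intro z hz
      simp at hz ⊢
      rw [abs_of_pos hr]
      nlinarith [norm_nonneg z]
    have hgd : DifferentiableOn ℂ (fun z => h (r * z)) (closedBall 0 1) :=
      hd.comp (by fun_prop) hmem
    have hg : DiffContOnCl ℂ (fun z => h (r * z)) (ball 0 1) := by
      refine DifferentiableOn.diffContOnCl ?_
      rwa [closure_ball _ one_ne_zero]
    have key := L1 (fun z => h (r * z)) hg (by
      intro z hz
      have := hsym _ (hmem z hz)
      simpa using this)
    have hcs : ∀ θ, circleMap 0 1 θ ∈ closedBall (0:ℂ) 1 := by
      intro θ; simp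
    have hcont : Continuous (fun θ : ℝ => (h (r * circleMap 0 1 θ)).re) := by
      refine Complex.continuous_re.comp ?_
      exact hgd.continuousOn.comp_continuous (by fun_prop) hcs
    obtain ⟨ν, hν⟩ := LM (fun θ => (2 * Real.pi)⁻¹ * (h 0).re⁻¹ * (h (r * circleMap 0 1 θ)).re)
      (by fun_prop) (fun θ => by
        have := hpos _ (hmem _ (hcs θ))
        positivity) (by
        have k0 := key 0 (by simp)
        simp only [KK, Real.circleAverage_def] at k0
        simp only [mul_zero, zero_mul, sub_zero, add_zero, ne_eq, OfNat.ofNat_ne_zero,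
          not_false_eq_true, zero_pow, div_one, one_mul] at k0
        rw [intervalIntegral.integral_ofReal, h0] at k0
        rw [intervalIntegral.integral_const_mul]
        have k1 := congrArg Complex.re k0
        simp at k1
        field_simp
        field_simp at k1
        rw [mul_comm Real.pi 2] at k1
        linarith)
    refine ⟨ν, fun v hv => ?_⟩
    rw [hν _ (hkc v hv), ← key v (by simpa using hv), Real.circleAverage_def,
      ← intervalIntegral.integral_smul, ← intervalIntegral.integral_const_mul]
    congr 1
    ext θ
    have : (circleMap 0 1 θ).re = Real.cos θ := by simp [circleMap, Complex.exp_ofReal_mul_I_re]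
    rw [h0]
    have hne : ((h 0).re : ℂ) ≠ 0 := by exact_mod_cast hp0.ne'
    simp only [this, cosX, Complex.real_smul, Complex.ofReal_re]
    push_cast
    field_simp
  let r : ℕ → ℝ := fun n => 1 - 1 / ((n:ℝ) + 2)
  have hr : ∀ n, 0 < r n ∧ r n < 1 := by
    intro n
    have : (0:ℝ) < (n:ℝ) + 2 := by positivity
    constructor
    · simp only [r, sub_pos, div_lt_one this]; linarith [(Nat.cast_nonneg n : (0:ℝ) ≤ n)]
    · simp only [r]; linarith [one_div_pos.2 this]
  have hrt : Tendsto r atTop (nhds 1) := by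
    have : Tendsto (fun n : ℕ => 1 / ((n:ℝ) + 2)) atTop (nhds 0) := by
      have := (tendsto_one_div_add_atTop_nhds_zero_nat (𝕜 := ℝ)).comp (tendsto_add_atTop_nat 1)
      refine this.congr (fun n => ?_)
      simp; ring
    simpa [r] using this.const_sub 1
  choose ν hν using fun n => step (r n) (hr n).1 (hr n).2
  let U : Ultrafilter ℕ := hyperfilter ℕ
  have hU : (U : Filter ℕ) ≤ atTop := Nat.hyperfilter_le_atTop
  let σ := (U.map ν).lim
  have hσ : Tendsto ν U (nhds σ) := (U.map ν).le_nhds_lim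
  rw [ProbabilityMeasure.tendsto_iff_forall_integral_rclike_tendsto ℂ] at hσ
  refine ⟨σ, fun v hv => ?_⟩
  have t1 := (hσ (BoundedContinuousFunction.mkOfCompact ⟨_, hkc v hv⟩)).const_mul (h 0)
  have t2 : Tendsto (fun n => h (r n * v)) U (nhds (h v)) := by
    have : ContinuousAt h v := (hd.differentiableAt (isOpen_ball.mem_nhds hv)).continuousAt
    refine this.tendsto.comp ?_
    have := ((Complex.continuous_ofReal.tendsto 1).comp (hrt.mono_left hU)).mul_const v
    simpa using this
  refine tendsto_nhds_unique t2 ?_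
  refine t1.congr (fun n => ?_)
  simpa using (hν n v hv).symm

lemma OmegaR_open : IsOpen OmegaR := by
  have : OmegaR = {z : ℂ | z.im = 0 ∧ 0 ≤ z.re}ᶜ := rfl
  rw [this, isOpen_compl_iff]
  exact (isClosed_eq Complex.continuous_im continuous_const).inter
    (isClosed_le continuous_const Complex.continuous_re)

lemma neg_sq_mem {u : ℂ} (hu : 0 < u.re) : -u^2 ∈ OmegaR := by
  rintro ⟨h1, h2⟩
  simp [pow_two] at h1 h2
  have : u.im = 0 := by
    have : u.re * u.im = 0 := by linarith
    rcases mul_eq_zero.1 this with h | h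
    · linarith
    · exact h
  rw [this] at h2
  nlinarith

lemma den_ne {z : ℂ} (hz : z ∈ OmegaR) {a b : ℝ} (ha : 0 ≤ a) (hb : 0 ≤ b) (hab : 0 < a + b) :
    (a : ℂ) - z * b ≠ 0 := by
  intro h
  have h1 := congrArg Complex.re h
  have h2 := congrArg Complex.im h
  simp at h1 h2
  rcases h2 with h2 | h2
  · have : z.re < 0 := by
      by_contra hc
      exact hz ⟨h2, not_lt.1 hc⟩
    nlinarith [mul_nonneg (neg_nonneg.2 this.le) hb]
  · subst h2
    simp at h1
    linarith

open ComplexConjugate Metric in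
lemma L3 (F : ℂ → ℂ) (hd : DifferentiableOn ℂ F OmegaR)
    (hsym : ∀ z ∈ OmegaR, F (conj z) = conj (F z))
    (hpos : ∀ u : ℂ, 0 < u.re → 0 < (u * F (-u^2)).re) :
    ∃ σ : ProbabilityMeasure XX, ∀ z ∈ OmegaR,
      F z = F (-1) * ∫ c : XX, 2 / (((1 - (c:ℝ) : ℝ) : ℂ) - z * ((1 + (c:ℝ) : ℝ) : ℂ))
        ∂(σ : Measure XX) := by
  have hne : ∀ v ∈ ball (0:ℂ) 1, 1 + v ≠ 0 := by
    intro v hv h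
    have : v = -1 := by linear_combination h
    subst this; simp at hv
  have hre : ∀ v ∈ ball (0:ℂ) 1, 0 < ((1 - v) / (1 + v)).re := by
    intro v hv
    have h3 : v.re^2 + v.im^2 < 1 := by
      have hv : ‖v‖ < 1 := by simpa using hv
      have : ‖v‖^2 < 1 := by nlinarith [norm_nonneg v]
      rw [← Complex.normSq_eq_norm_sq, Complex.normSq_apply] at this
      nlinarith
    have := Complex.normSq_pos.2 (hne v hv)
    rw [Complex.div_re, ← add_div]
    refine div_pos ?_ this
    simp
    nlinarith
  obtain ⟨σ, hσ⟩ := L2 (fun v => (1 - v) / (1 + v) * F (-((1 - v) / (1 + v))^2)) (by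
      have h1 : DifferentiableOn ℂ (fun v : ℂ => (1 - v) / (1 + v)) (ball 0 1) :=
        DifferentiableOn.div (by fun_prop) (by fun_prop) hne
      refine h1.mul ?_
      exact hd.comp (h1.pow 2).neg (fun v hv => neg_sq_mem (hre v hv)))
    (by
      intro v hv
      have := hsym _ (neg_sq_mem (hre v hv))
      simp only [map_neg, map_pow, map_div₀, map_sub, map_add, map_one, map_mul] at this ⊢
      rw [this])
    (fun v hv => hpos _ (hre v hv))
  refine ⟨σ, fun z hz => ?_⟩
  obtain ⟨u, hu, hure⟩ : ∃ u : ℂ, u^2 = -z ∧ 0 < u.re := by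
    obtain ⟨w, hw⟩ := IsAlgClosed.exists_pow_nat_eq (-z) (n := 2) (by norm_num)
    rcases lt_trichotomy w.re 0 with h | h | h
    · exact ⟨-w, by rw [neg_sq, hw], by simpa using h⟩
    · exfalso
      apply hz
      have : z = -w^2 := by rw [hw]; ring
      subst this
      simp [pow_two, h]
      nlinarith
    · exact ⟨w, hw, h⟩
  have hu1 : 1 + u ≠ 0 := by
    intro h
    have := congrArg Complex.re h
    simp at this; linarith
  have hu0 : u ≠ 0 := by rintro rfl; simp at hure
  have hv : (1 - u) / (1 + u) ∈ ball (0:ℂ) 1 := by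
    rw [mem_ball_zero_iff, norm_div, div_lt_one (norm_pos_iff.2 hu1)]
    refine lt_of_pow_lt_pow_left₀ 2 (norm_nonneg _) ?_
    rw [← Complex.normSq_eq_norm_sq, ← Complex.normSq_eq_norm_sq, Complex.normSq_apply,
      Complex.normSq_apply]
    simp
    nlinarith
  have huv : (1 - (1 - u) / (1 + u)) / (1 + (1 - u) / (1 + u)) = u := by
    field_simp
    ring
  have hz' : z = -u^2 := by rw [hu]; ring
  have key := hσ _ hv
  simp only [huv, ← hz'] at key
  simp only [sub_zero, add_zero, div_one, one_mul, one_pow] at key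
  have : ∀ c : XX, KK ((1 - u) / (1 + u)) (c:ℝ) =
      u * (2 / (((1 - (c:ℝ) : ℝ) : ℂ) - z * ((1 + (c:ℝ) : ℝ) : ℂ))) := by
    intro c
    have d1 := KK_den (mem_ball_zero_iff.1 hv) c.2
    have d2 := den_ne hz (a := 1 - (c:ℝ)) (b := 1 + (c:ℝ)) (by linarith [c.2.2]) (by linarith [c.2.1])
      (by linarith)
    unfold KK
    rw [← mul_div_assoc u 2, div_eq_div_iff d1 d2, hz']
    push_cast
    field_simp
    ring
  simp only [this] at key
  rw [integral_const_mul] at key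
  refine mul_left_cancel₀ hu0 ?_
  rw [key]; ring

lemma L4 {u w : ℂ} (hu : 0 < u.re) (hw : 0 < w.im) (him : u.im < 0)
    (h : 0 ≤ (w * (starRingEnd ℂ) (-u^2)).im) : 0 < (u * (1 / (1 - w))).re := by
  have h1 : 1 - w ≠ 0 := by
    intro h; have := congrArg Complex.im h; simp at this; linarith
  have h2 := Complex.normSq_pos.2 h1
  rw [mul_one_div, Complex.div_re, ← add_div]
  refine div_pos ?_ h2
  simp [pow_two] at h ⊢
  nlinarith [mul_pos hw (mul_pos hu hu), sq_nonneg u.im, mul_pos_of_neg_of_neg him him]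

lemma arg_to_im {w z : ℂ} (hz : 0 < z.im) (h : w.arg ∈ Set.Ico z.arg Real.pi) (hw : w ≠ 0) :
    0 < w.im ∧ 0 ≤ (w * (starRingEnd ℂ) z).im := by
  obtain ⟨h1, h2⟩ := h
  have ha : 0 < z.arg := by
    rcases lt_or_eq_of_le (Complex.arg_nonneg_iff.2 hz.le) with h | h
    · exact h
    · exact absurd (Complex.arg_eq_zero_iff.1 h.symm).2 hz.ne'
  have hwn := norm_pos_iff.2 hw
  have e1 : w.im = ‖w‖ * Real.sin w.arg := (Complex.norm_mul_sin_arg w).symm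
  have e2 : w.re = ‖w‖ * Real.cos w.arg := (Complex.norm_mul_cos_arg w).symm
  have e3 : z.im = ‖z‖ * Real.sin z.arg := (Complex.norm_mul_sin_arg z).symm
  have e4 : z.re = ‖z‖ * Real.cos z.arg := (Complex.norm_mul_cos_arg z).symm
  refine ⟨?_, ?_⟩
  · rw [e1]; exact mul_pos hwn (Real.sin_pos_of_pos_of_lt_pi (by linarith) h2)
  · have : (w * (starRingEnd ℂ) z).im = ‖w‖ * ‖z‖ * Real.sin (w.arg - z.arg) := by
      rw [Real.sin_sub]
      simp only [Complex.mul_im, Complex.conj_re, Complex.conj_im]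
      rw [e1, e2, e3, e4]; ring
    rw [this]
    exact mul_nonneg (by positivity) (Real.sin_nonneg_of_nonneg_of_le_pi (by linarith) (by linarith))

lemma im_to_arg {w z : ℂ} (hz : 0 < z.im) (hw : 0 < w.im) (h : 0 ≤ (w * (starRingEnd ℂ) z).im) :
    w.arg ∈ Set.Ico z.arg Real.pi := by
  have hlt : ∀ {z : ℂ}, 0 < z.im → z.arg < Real.pi := by
    intro z hz
    refine lt_of_le_of_ne (Complex.arg_le_pi z) ?_
    intro h
    exact hz.ne' (Complex.arg_eq_pi_iff.1 h).2
  refine ⟨?_, hlt hw⟩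
  have e1 : w.im = ‖w‖ * Real.sin w.arg := (Complex.norm_mul_sin_arg w).symm
  have e2 : w.re = ‖w‖ * Real.cos w.arg := (Complex.norm_mul_cos_arg w).symm
  have e3 : z.im = ‖z‖ * Real.sin z.arg := (Complex.norm_mul_sin_arg z).symm
  have e4 : z.re = ‖z‖ * Real.cos z.arg := (Complex.norm_mul_cos_arg z).symm
  have : (w * (starRingEnd ℂ) z).im = ‖w‖ * ‖z‖ * Real.sin (w.arg - z.arg) := by
    rw [Real.sin_sub]
    simp only [Complex.mul_im, Complex.conj_re, Complex.conj_im]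
    rw [e1, e2, e3, e4]; ring
  rw [this] at h
  by_contra hc
  push Not at hc
  have hw0 : w ≠ 0 := by rintro rfl; simp at hw
  have hz0 : z ≠ 0 := by rintro rfl; simp at hz
  have : Real.sin (w.arg - z.arg) < 0 := Real.sin_neg_of_neg_of_neg_pi_lt (by linarith)
    (by linarith [hlt hz, Complex.arg_nonneg_iff.2 hw.le])
  have := mul_neg_of_pos_of_neg (mul_pos (norm_pos_iff.2 hw0) (norm_pos_iff.2 hz0)) this
  linarith

lemma bdd_ker {z : ℂ} (hz : z ∈ OmegaR) : ∃ C : ℝ, ∀ s : ℝ, 0 ≤ s →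
    ‖1 / (1 - z * s)‖ ≤ C ∧ ‖(s:ℂ) / (1 - z * s)‖ ≤ C := by
  have hc : ContinuousOn (fun t : ℝ => 1 / ((t:ℂ) - z * ((1 - t : ℝ) : ℂ))) (Set.Icc 0 1) := by
    refine ContinuousOn.div (by fun_prop) (by fun_prop) ?_
    intro t ht
    exact den_ne hz ht.1 (by linarith [ht.2]) (by linarith)
  obtain ⟨C, hC⟩ := isCompact_Icc.exists_bound_of_continuousOn hc
  refine ⟨C, fun s hs => ?_⟩
  have h1s : 0 < 1 + s := by linarith
  have ht : 1 / (1 + s) ∈ Set.Icc (0:ℝ) 1 := ⟨by positivity, by rw [div_le_one h1s]; linarith⟩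
  have := hC _ ht
  have hne : (1 + s : ℂ) ≠ 0 := by exact_mod_cast h1s.ne'
  have hden : 1 - z * (s:ℂ) ≠ 0 := by
    have := den_ne hz (a := 1) (b := s) (by norm_num) hs (by linarith)
    simpa using this
  have e : 1 / (((1 / (1 + s) : ℝ):ℂ) - z * ((1 - 1 / (1 + s) : ℝ) : ℂ)) = (1 + s) * (1 / (1 - z * s)) := by
    have : (((1 / (1 + s) : ℝ):ℂ) - z * ((1 - 1 / (1 + s) : ℝ) : ℂ)) = (1 - z * s) / (1 + s) := by
      push_cast
      field_simp
      ring
    rw [this]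
    field_simp
  rw [e, norm_mul] at this
  have hn : ‖(1 + s : ℂ)‖ = 1 + s := by
    have : (1 + s : ℂ) = ((1 + s : ℝ) : ℂ) := by push_cast; rfl
    rw [this, Complex.norm_real, Real.norm_of_nonneg h1s.le]
  rw [hn] at this
  have hk := norm_nonneg (1 / (1 - z * (s:ℂ)))
  refine ⟨by nlinarith, ?_⟩
  have : (s:ℂ) / (1 - z * s) = s * (1 / (1 - z * s)) := by ring
  rw [this, norm_mul, Complex.norm_real, Real.norm_of_nonneg hs]
  nlinarith

lemma int_ker {μ : Measure ℝ} [IsProbabilityMeasure μ] (hμ : ∀ᵐ s ∂μ, 0 ≤ s) {z : ℂ}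
    (hz : z ∈ OmegaR) : Integrable (fun s : ℝ => 1 / (1 - z * (s:ℂ))) μ := by
  obtain ⟨C, hC⟩ := bdd_ker hz
  refine Integrable.of_bound (C := C) ?_ ?_
  · refine Measurable.aestronglyMeasurable ?_
    fun_prop
  · filter_upwards [hμ] with s hs using (hC s hs).1

lemma psi_eq {μ : Measure ℝ} [IsProbabilityMeasure μ] (hμ : ∀ᵐ s ∂μ, 0 ≤ s) {z : ℂ}
    (hz : z ∈ OmegaR) : psiR μ z = (∫ s : ℝ, 1 / (1 - z * (s:ℂ)) ∂μ) - 1 := by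
  have : (1:ℂ) = ∫ s : ℝ, (1:ℂ) ∂μ := by simp
  nth_rewrite 3 [this]
  rw [← integral_sub (int_ker hμ hz) (integrable_const _)]
  unfold psiR
  refine integral_congr_ae ?_
  filter_upwards [hμ] with s hs
  have hden : 1 - z * (s:ℂ) ≠ 0 := by
    have := den_ne hz (a := 1) (b := s) (by norm_num) hs (by linarith)
    simpa using this
  field_simp
  ring

lemma fwd_arg {μ : Measure ℝ} [IsProbabilityMeasure μ] (hμ : ∀ᵐ s ∂μ, 0 ≤ s)
    (hd : μ ≠ Measure.dirac 0) {z : ℂ} (hz : 0 < z.im) :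
    0 < (etaR μ z).im ∧ 0 ≤ (etaR μ z * (starRingEnd ℂ) z).im := by
  have hzO : z ∈ OmegaR := fun h => hz.ne' h.1
  obtain ⟨C, hC⟩ := bdd_ker hzO
  have hden : ∀ s : ℝ, 1 - z * (s:ℂ) ≠ 0 := by
    intro s h
    have h2 := congrArg Complex.im h
    have h1 := congrArg Complex.re h
    simp at h1 h2
    rcases h2 with h2 | h2
    · exact hz.ne' h2
    · simp [h2] at h1
  let D : ℝ → ℝ := fun s => Complex.normSq (1 - z * (s:ℂ))
  have hD : ∀ s, 0 < D s := fun s => Complex.normSq_pos.2 (hden s)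
  have hDm : Measurable D := by
    refine Continuous.measurable ?_
    exact Complex.continuous_normSq.comp (by fun_prop)
  have n1 : ∀ s, 1 / D s = ‖1 / (1 - z * (s:ℂ))‖^2 := by
    intro s; simp [D, Complex.normSq_eq_norm_sq]
  have n2 : ∀ s, s^2 / D s = ‖(s:ℂ) / (1 - z * (s:ℂ))‖^2 := by
    intro s; simp [D, Complex.normSq_eq_norm_sq, div_pow]
  have b0 : ∀ s, 0 ≤ s → 1 / D s ≤ C^2 := by
    intro s hs; rw [n1]
    exact pow_le_pow_left₀ (norm_nonneg _) (hC s hs).1 2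
  have b2 : ∀ s, 0 ≤ s → s^2 / D s ≤ C^2 := by
    intro s hs; rw [n2]
    exact pow_le_pow_left₀ (norm_nonneg _) (hC s hs).2 2
  have i0 : Integrable (fun s => 1 / D s) μ := by
    refine Integrable.of_bound (C := C^2) (Measurable.aestronglyMeasurable (by fun_prop)) ?_
    filter_upwards [hμ] with s hs
    rw [Real.norm_of_nonneg (by have := hD s; positivity)]
    exact b0 s hs
  have i2 : Integrable (fun s => s^2 / D s) μ := by
    refine Integrable.of_bound (C := C^2) (Measurable.aestronglyMeasurable (by fun_prop)) ?_
    filter_upwards [hμ] with s hs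
    rw [Real.norm_of_nonneg (by have := hD s; positivity)]
    exact b2 s hs
  have i1 : Integrable (fun s => s / D s) μ := by
    refine Integrable.of_bound (C := C^2) (Measurable.aestronglyMeasurable (by fun_prop)) ?_
    filter_upwards [hμ] with s hs
    rw [Real.norm_of_nonneg (by have := hD s; positivity)]
    have h0 := b0 s hs
    have h2 := b2 s hs
    have : s / D s ≤ (1 / D s + s^2 / D s) / 2 := by
      rw [← add_div, div_div, div_le_div_iff₀ (hD s) (by have := hD s; positivity)]
      nlinarith [hD s, mul_nonneg (hD s).le (sq_nonneg (s - 1))]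
    linarith
  set a := ∫ s, 1 / D s ∂μ with ha
  set b := ∫ s, s / D s ∂μ with hb
  set c := ∫ s, s^2 / D s ∂μ with hc
  have hB : ∫ s : ℝ, 1 / (1 - z * (s:ℂ)) ∂μ = a - b * (starRingEnd ℂ) z := by
    rw [ha, hb, ← integral_complex_ofReal, ← integral_complex_ofReal, ← integral_mul_const,
      ← integral_sub i0.ofReal (i1.ofReal.mul_const _)]
    refine integral_congr_ae (Eventually.of_forall fun s => ?_)
    have e : (D s : ℂ) = (1 - z * s) * (1 - (starRingEnd ℂ) z * s) := by
      simp only [D]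
      rw [Complex.normSq_eq_conj_mul_self]; simp; ring
    have e0 : (D s : ℂ) ≠ 0 := by exact_mod_cast (hD s).ne'
    have := hden s
    simp only [Complex.ofReal_div, Complex.ofReal_one]
    rw [div_mul_eq_mul_div, ← sub_div, div_eq_div_iff this e0, e]
    ring
  have hP : psiR μ z = z * (b - c * (starRingEnd ℂ) z) := by
    rw [hc, hb, ← integral_complex_ofReal, ← integral_complex_ofReal, ← integral_mul_const,
      ← integral_sub i1.ofReal (i2.ofReal.mul_const _), ← integral_const_mul]
    refine integral_congr_ae (Eventually.of_forall fun s => ?_)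
    have e : (D s : ℂ) = (1 - z * s) * (1 - (starRingEnd ℂ) z * s) := by
      simp only [D]
      rw [Complex.normSq_eq_conj_mul_self]; simp; ring
    have e0 : (D s : ℂ) ≠ 0 := by exact_mod_cast (hD s).ne'
    have := hden s
    simp only [Complex.ofReal_div, Complex.ofReal_pow]
    rw [div_mul_eq_mul_div, ← sub_div, ← mul_div_assoc, div_eq_div_iff this e0, e]
    ring
  have hBP := psi_eq hμ hzO
  have hone := hBP
  rw [hB, hP] at hone
  have hone' := congrArg Complex.re hone
  simp at hone'
  have hCS : b^2 ≤ a * c := by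
    have : ∀ t : ℝ, 0 ≤ a * (t * t) + (-2 * b) * t + c := by
      intro t
      have h1 : a * (t * t) + (-2 * b) * t + c = ∫ s, (s - t)^2 / D s ∂μ := by
        rw [ha, hb, hc, ← integral_mul_const, ← integral_const_mul, ← integral_mul_const,
          ← integral_add, ← integral_add]
        · refine integral_congr_ae (Eventually.of_forall fun s => ?_)
          simp only; ring
        · exact (i0.mul_const _).add ((i1.const_mul _).mul_const _)
        · exact i2
        · exact i0.mul_const _
        · exact (i1.const_mul _).mul_const _
      rw [h1]
      refine integral_nonneg fun s => ?_
      have := hD s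
      simp only [Pi.zero_apply]
      positivity
    have := discrim_le_zero this
    unfold discrim at this
    nlinarith
  have hbn : (0 : ℝ → ℝ) ≤ᵐ[μ] fun s => s / D s := by
    filter_upwards [hμ] with s hs
    have := hD s
    simp only [Pi.zero_apply]
    positivity
  have hbpos : 0 < b := by
    refine lt_of_le_of_ne (integral_nonneg_of_ae hbn) ?_
    intro h
    apply hd
    have h0 := (integral_eq_zero_iff_of_nonneg_ae hbn i1).1 h.symm
    have h1 : (id : ℝ → ℝ) =ᵐ[μ] fun _ => 0 := by
      filter_upwards [h0] with s hs
      have := hD s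
      simp at hs
      rcases hs with hs | hs
      · exact hs
      · linarith
    have : μ.map (id : ℝ → ℝ) = μ.map (fun _ => (0:ℝ)) := Measure.map_congr h1
    rw [Measure.map_id, Measure.map_const] at this
    simpa using this
  have hBim : 0 < (a - b * (starRingEnd ℂ) z : ℂ).im := by
    simp; positivity
  have hB0 : (a - b * (starRingEnd ℂ) z : ℂ) ≠ 0 := by
    intro h; rw [h] at hBim; simp at hBim
  have hN := Complex.normSq_pos.2 hB0
  have heta : etaR μ z = z * (b - c * (starRingEnd ℂ) z) / (a - b * (starRingEnd ℂ) z) := by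
    unfold etaR
    rw [hP, hone]
    congr 1
    ring
  have heta2 : etaR μ z = (z * (b - c * (starRingEnd ℂ) z) * (a - b * z))
      * ((Complex.normSq (a - b * (starRingEnd ℂ) z : ℂ))⁻¹ : ℝ) := by
    rw [heta, div_eq_mul_inv, Complex.inv_def]
    simp
    ring
  have hNi := inv_pos.2 hN
  rw [heta2]
  set N := (Complex.normSq (a - b * (starRingEnd ℂ) z : ℂ))⁻¹
  constructor
  · rw [Complex.im_mul_ofReal]
    refine mul_pos ?_ hNi
    have : (z * (b - c * (starRingEnd ℂ) z) * (a - b * z)).im = z.im * b := by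
      simp
      linear_combination (-(z.im * b)) * hone'
    rw [this]; positivity
  · rw [mul_right_comm, Complex.im_mul_ofReal]
    refine mul_nonneg ?_ hNi.le
    have : (z * (b - c * (starRingEnd ℂ) z) * (a - b * z) * (starRingEnd ℂ) z).im =
        (z.re^2 + z.im^2) * z.im * (a * c - b^2) := by
      simp
      ring
    rw [this]
    exact mul_nonneg (by positivity) (by linarith)

lemma fwd_lim {μ : Measure ℝ} [IsProbabilityMeasure μ] (hμ : ∀ᵐ s ∂μ, 0 ≤ s) :
    Tendsto (fun x : ℝ => etaR μ (x:ℂ)) (nhdsWithin 0 (Set.Iio 0)) (nhds 0) := by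
  have : Tendsto (fun x : ℝ => psiR μ (x:ℂ)) (nhdsWithin 0 (Set.Iio 0)) (nhds 0) := by
    have h0 : (0:ℂ) = ∫ s : ℝ, (0:ℂ) ∂μ := by simp
    rw [h0]
    refine tendsto_integral_filter_of_dominated_convergence (fun _ => 1) ?_ ?_ ?_ ?_
    · refine Eventually.of_forall fun x => Measurable.aestronglyMeasurable ?_
      fun_prop
    · filter_upwards [self_mem_nhdsWithin] with x hx
      filter_upwards [hμ] with s hs
      have hx : x < 0 := hx
      have : (x:ℂ) * s / (1 - x * s) = ((x * s / (1 - x * s) : ℝ) : ℂ) := by push_cast; rfl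
      rw [this, Complex.norm_real, Real.norm_eq_abs, abs_le]
      have : 0 < 1 - x * s := by nlinarith
      constructor
      · rw [le_div_iff₀ this]; linarith
      · rw [div_le_one this]; nlinarith
    · exact integrable_const _
    · refine Eventually.of_forall fun s => ?_
      have : ContinuousAt (fun x : ℝ => (x:ℂ) * s / (1 - x * s)) 0 := by
        refine ContinuousAt.div (by fun_prop) (by fun_prop) (by simp)
      have h := this.tendsto
      simp at h
      exact h.mono_left nhdsWithin_le_nhds
  have h2 := this.div (this.const_add 1) (by simp)
  simp only [zero_div, add_zero] at h2
  exact h2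

lemma L5 (F : ℂ → ℂ) (A : ℝ) (hA : 0 < A) (σ : Measure XX) [IsProbabilityMeasure σ]
    (hF : ∀ z ∈ OmegaR, F z = A * ∫ c : XX, 2 / (((1 - (c:ℝ) : ℝ) : ℂ) - z * ((1 + (c:ℝ) : ℝ) : ℂ)) ∂σ)
    (hlim : Tendsto (fun x : ℝ => F x) (nhdsWithin 0 (Set.Iio 0)) (nhds 1)) :
    ∃ μ : Measure ℝ, IsProbabilityMeasure μ ∧ μ (Set.Iio 0) = 0 ∧
      ∀ z ∈ OmegaR, F z = ∫ s : ℝ, 1 / (1 - z * (s:ℂ)) ∂μ := by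
  let e : ℕ → ℝ := fun n => 1 / ((n:ℝ) + 1)
  have he : ∀ n, 0 < e n := fun n => by simp only [e]; positivity
  have het : Tendsto e atTop (nhds 0) := tendsto_one_div_add_atTop_nhds_zero_nat
  have hea : Antitone e := by
    intro m n hmn
    simp only [e]
    have : (m:ℝ) ≤ n := by exact_mod_cast hmn
    gcongr
  let d : ℕ → XX → ℝ := fun n c => (1 - (c:ℝ)) + e n * (1 + (c:ℝ))
  have hd : ∀ n c, 0 < d n c := by
    intro n c
    have h1 := c.2.1
    have h2 := c.2.2
    have := he n
    simp only [d]
    rcases eq_or_lt_of_le h2 with h | h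
    · rw [h]; linarith
    · nlinarith
  let k : ℕ → XX → ENNReal := fun n c => ENNReal.ofReal (2 * A) / ENNReal.ofReal (d n c)
  let G : XX → ENNReal := fun c => ENNReal.ofReal (2 * A) / ENNReal.ofReal (1 - (c:ℝ))
  have hGm : Measurable G := by simp only [G]; fun_prop
  have hkF : ∀ n, ∫⁻ c, k n c ∂σ = ENNReal.ofReal (F ((-e n : ℝ) : ℂ)).re := by
    intro n
    have hmem : ((-e n : ℝ) : ℂ) ∈ OmegaR := by
      rintro ⟨_, h⟩
      simp at h; linarith [he n]
    have h1 : F ((-e n : ℝ) : ℂ) = ((∫ c : XX, 2 * A / d n c ∂σ : ℝ) : ℂ) := by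
      rw [hF _ hmem, ← integral_complex_ofReal, ← integral_const_mul]
      refine integral_congr_ae (Eventually.of_forall fun c => ?_)
      simp only [d]
      push_cast
      rw [mul_div_assoc']
      congr 1 <;> ring
    rw [h1, Complex.ofReal_re, ofReal_integral_eq_lintegral_ofReal]
    · refine lintegral_congr fun c => ?_
      simp only [k]
      rw [ENNReal.ofReal_div_of_pos (hd n c)]
    · have : Continuous (fun c : XX => 2 * A / d n c) :=
        Continuous.div (by fun_prop) (by simp only [d]; fun_prop) (fun c => (hd n c).ne')
      exact this.integrable_of_hasCompactSupport (HasCompactSupport.of_compactSpace _)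
    · exact Eventually.of_forall fun c => by
        have := hd n c
        simp only [Pi.zero_apply]
        positivity
  have t1 : Tendsto (fun n => ∫⁻ c, k n c ∂σ) atTop (nhds 1) := by
    simp only [hkF]
    have : Tendsto (fun n => (F ((-e n : ℝ) : ℂ)).re) atTop (nhds 1) := by
      have h1 : Tendsto (fun n => -e n) atTop (nhdsWithin 0 (Set.Iio 0)) := by
        refine tendsto_nhdsWithin_iff.2 ⟨by simpa using het.neg, Eventually.of_forall fun n => ?_⟩
        simpa using he n
      have h2 := (Complex.continuous_re.tendsto 1).comp (hlim.comp h1)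
      rw [Complex.one_re] at h2
      exact h2
    simpa using ENNReal.tendsto_ofReal this
  have t2 : Tendsto (fun n => ∫⁻ c, k n c ∂σ) atTop (nhds (∫⁻ c, G c ∂σ)) := by
    refine lintegral_tendsto_of_tendsto_of_monotone ?_ ?_ ?_
    · intro n
      simp only [k, d]
      refine Measurable.aemeasurable ?_
      fun_prop
    · refine Eventually.of_forall fun c => ?_
      intro m n hmn
      simp only [k]
      refine ENNReal.div_le_div_left (ENNReal.ofReal_le_ofReal ?_) _
      simp only [d]
      have := hea hmn
      have h1 := c.2.1
      nlinarith
    · refine Eventually.of_forall fun c => ?_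
      simp only [k, G]
      refine ENNReal.Tendsto.const_div (ENNReal.tendsto_ofReal ?_) (Or.inr ENNReal.ofReal_ne_top)
      have := (het.mul_const (1 + (c:ℝ))).const_add (1 - (c:ℝ))
      simpa [d] using this
  have hG1 : ∫⁻ c, G c ∂σ = 1 := tendsto_nhds_unique t2 t1
  have hGfin : ∀ᵐ c ∂σ, G c < ⊤ := ae_lt_top hGm (by rw [hG1]; simp)
  let S : XX → ℝ := fun c => (1 + (c:ℝ)) / (1 - (c:ℝ))
  have hSm : Measurable S := by simp only [S]; fun_prop
  have hp : IsProbabilityMeasure (σ.withDensity G) := by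
    constructor
    rw [withDensity_apply _ MeasurableSet.univ, setLIntegral_univ, hG1]
  refine ⟨(σ.withDensity G).map S, Measure.isProbabilityMeasure_map hSm.aemeasurable, ?_, ?_⟩
  · rw [Measure.map_apply hSm measurableSet_Iio]
    have : S ⁻¹' Set.Iio 0 = ∅ := by
      ext c
      simp only [Set.mem_preimage, Set.mem_Iio, Set.mem_empty_iff_false, iff_false, not_lt, S]
      exact div_nonneg (by linarith [c.2.1]) (by linarith [c.2.2])
    rw [this]; simp
  · intro z hz
    rw [integral_map hSm.aemeasurable (Measurable.aestronglyMeasurable (by fun_prop)),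
      integral_withDensity_eq_integral_toReal_smul hGm hGfin, hF z hz, ← integral_const_mul]
    refine integral_congr_ae ?_
    filter_upwards [hGfin] with c hc
    have h1 : 0 < 1 - (c:ℝ) := by
      by_contra hcon
      have h0 : ENNReal.ofReal (1 - (c:ℝ)) = 0 := ENNReal.ofReal_eq_zero.2 (not_lt.1 hcon)
      simp only [G, h0] at hc
      rw [ENNReal.div_zero (by simpa using hA)] at hc
      exact lt_irrefl _ hc
    have h2 : (G c).toReal = 2 * A / (1 - (c:ℝ)) := by
      simp only [G]
      rw [← ENNReal.ofReal_div_of_pos h1, ENNReal.toReal_ofReal (by positivity)]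
    have h3 := den_ne hz (a := 1 - (c:ℝ)) (b := 1 + (c:ℝ)) h1.le (by linarith [c.2.1]) (by linarith)
    have h4 : ((1 - (c:ℝ) : ℝ) : ℂ) ≠ 0 := by exact_mod_cast h1.ne'
    have h5 : 1 - z * (S c : ℂ) = (((1 - (c:ℝ) : ℝ) : ℂ) - z * ((1 + (c:ℝ) : ℝ) : ℂ)) / ((1 - (c:ℝ) : ℝ) : ℂ) := by
      simp only [S, Complex.ofReal_div]
      rw [sub_div, div_self h4, mul_div_assoc]
    rw [h2, h5, Complex.real_smul, one_div_div, Complex.ofReal_div]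
    field_simp
    push_cast
    ring

lemma bwd (η : ℂ → ℂ)
    (hη : AnalyticOnNhd ℂ η OmegaR)
    (hne : ∀ z ∈ OmegaR, η z ≠ 0)
    (hconj : ∀ z ∈ OmegaR, η (starRingEnd ℂ z) = starRingEnd ℂ (η z))
    (hlim : Tendsto (fun x : ℝ => η (x : ℂ)) (nhdsWithin 0 (Set.Iio 0)) (nhds 0))
    (harg : ∀ z : ℂ, 0 < z.im → (η z).arg ∈ Set.Ico z.arg Real.pi) :
    ∃ μ : Measure ℝ, IsProbabilityMeasure μ ∧ μ (Set.Iio 0) = 0 ∧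
        μ ≠ Measure.dirac 0 ∧ ∀ z ∈ OmegaR, η z = etaR μ z := by
  have hup : ∀ {z : ℂ}, 0 < z.im → z ∈ OmegaR := fun hz h => hz.ne' h.1
  have hnegm : ∀ {x : ℝ}, x < 0 → (x:ℂ) ∈ OmegaR := by
    rintro x hx ⟨_, h⟩
    simp at h; linarith
  have him : ∀ z : ℂ, 0 < z.im → 0 < (η z).im ∧ 0 ≤ (η z * (starRingEnd ℂ) z).im :=
    fun z hz => arg_to_im hz (harg z hz) (hne z (hup hz))
  have hreal : ∀ x : ℝ, x < 0 → ∃ y : ℝ, y < 0 ∧ η x = y := by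
    intro x hx
    have h1 := hconj x (hnegm hx)
    rw [Complex.conj_ofReal] at h1
    have h2 := Complex.conj_eq_iff_re.1 h1.symm
    refine ⟨(η x).re, ?_, h2.symm⟩
    have h3 : (η x).re ≤ 0 := by
      have hc : ContinuousAt η x := (hη x (hnegm hx)).continuousAt
      have hp : Tendsto (fun ε : ℝ => (x:ℂ) + ε * Complex.I) (nhdsWithin 0 (Set.Ioi 0)) (nhds (x:ℂ)) := by
        have : Continuous (fun ε : ℝ => (x:ℂ) + ε * Complex.I) := by fun_prop
        have := this.tendsto 0
        simp at this
        exact this.mono_left nhdsWithin_le_nhds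
      have ht := (Complex.continuous_re.tendsto _).comp (hc.tendsto.comp hp)
      refine le_of_tendsto ht ?_
      filter_upwards [self_mem_nhdsWithin] with ε hε
      have hε : 0 < ε := hε
      obtain ⟨g1, g2⟩ := him ((x:ℂ) + ε * Complex.I) (by simpa using hε)
      simp at g2
      simp only [Function.comp]
      by_contra hcon
      push Not at hcon
      nlinarith [mul_pos hcon hε, mul_neg_of_pos_of_neg g1 hx]
    refine lt_of_le_of_ne h3 ?_
    intro h
    rw [h] at h2
    exact hne x (hnegm hx) (by rw [← h2]; simp)
  have hcases : ∀ z ∈ OmegaR, 0 < z.im ∨ 0 < ((starRingEnd ℂ) z).im ∨ ∃ x : ℝ, x < 0 ∧ z = x := by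
    intro z hz
    rcases lt_trichotomy z.im 0 with h | h | h
    · right; left; simpa using h
    · right; right
      refine ⟨z.re, ?_, ?_⟩
      · by_contra hc
        exact hz ⟨h, not_lt.1 hc⟩
      · apply Complex.ext <;> simp [h]
    · left; exact h
  have hF0 : ∀ z ∈ OmegaR, 1 - η z ≠ 0 := by
    intro z hz h
    have h' : η z = 1 := by linear_combination -h
    rcases hcases z hz with h1 | h1 | ⟨x, hx, rfl⟩
    · have := (him z h1).1
      rw [h'] at this; simp at this
    · have := (him _ h1).1
      rw [hconj z hz, h'] at this; simp at this
    · obtain ⟨y, hy, hyx⟩ := hreal x hx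
      rw [hyx] at h'
      have : y = 1 := by exact_mod_cast h'
      linarith
  obtain ⟨σ, hσ⟩ := L3 (fun z => 1 / (1 - η z)) (by
      intro z hz
      have h1 := (hη z hz).differentiableAt
      have h2 := hF0 z hz
      refine DifferentiableAt.differentiableWithinAt ?_
      fun_prop (disch := assumption))
    (by
      intro z hz
      rw [hconj z hz]; simp)
    (by
      intro u hu
      rcases lt_trichotomy u.im 0 with h | h | h
      · have h1 : 0 < (-u^2).im := by
          simp [pow_two]; nlinarith [mul_pos hu (neg_pos.2 h)]
        exact L4 hu (him _ h1).1 h (him _ h1).2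
      · have h2 : -u^2 = ((-u.re^2 : ℝ) : ℂ) := by
          apply Complex.ext <;> simp [pow_two, h]
        obtain ⟨y, hy, hyx⟩ := hreal (-u.re^2) (by nlinarith)
        rw [h2, hyx]
        have : (1 / (1 - (y:ℂ))) = ((1 / (1 - y) : ℝ) : ℂ) := by push_cast; rfl
        rw [this, Complex.re_mul_ofReal]
        have : 0 < 1 - y := by linarith
        positivity
      · have h1 : 0 < (-((starRingEnd ℂ) u)^2).im := by
          simp [pow_two]; nlinarith [mul_pos hu h]
        have h2 := L4 (u := (starRingEnd ℂ) u) (by simpa using hu) (him _ h1).1 (by simpa using h) (him _ h1).2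
        have h3 := hconj _ (neg_sq_mem hu)
        simp only [map_neg, map_pow] at h3
        rw [h3] at h2
        have h4 : (starRingEnd ℂ) u * (1 / (1 - (starRingEnd ℂ) (η (-u^2)))) =
            (starRingEnd ℂ) (u * (1 / (1 - η (-u^2)))) := by simp
        rw [h4, Complex.conj_re] at h2
        exact h2)
  obtain ⟨y, hy, hyx⟩ := hreal (-1) (by norm_num)
  have hA : 0 < 1 / (1 - y) := by
    have : 0 < 1 - y := by linarith
    positivity
  obtain ⟨μ, hμ1, hμ2, hμ3⟩ := L5 (fun z => 1 / (1 - η z)) (1 / (1 - y)) hA (σ : Measure XX) (by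
      intro z hz
      have := hσ z hz
      rw [this]
      have h1 : η (-1) = y := by rw [← hyx]; simp
      rw [h1]; push_cast; rfl) (by
      have := (hlim.const_sub 1).inv₀ (by simp)
      simpa using this)
  have hμ0 : ∀ᵐ s ∂μ, 0 ≤ s := by
    rw [ae_iff]
    have : {s : ℝ | ¬ 0 ≤ s} = Set.Iio 0 := by ext s; simp
    rw [this, hμ2]
  have hfin : ∀ z ∈ OmegaR, η z = etaR μ z := by
    intro z hz
    unfold etaR
    rw [psi_eq hμ0 hz, ← hμ3 z hz]
    have := hF0 z hz
    field_simp
    ring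
  refine ⟨μ, hμ1, hμ2, ?_, hfin⟩
  rintro rfl
  have hm : ((-1:ℝ):ℂ) ∈ OmegaR := hnegm (by norm_num)
  apply hne _ hm
  rw [hfin _ hm]
  simp [etaR, psiR]

theorem stmt0 (η : ℂ → ℂ)
    (hη : AnalyticOnNhd ℂ η OmegaR)
    (hne : ∀ z ∈ OmegaR, η z ≠ 0)
    (hconj : ∀ z ∈ OmegaR, η (starRingEnd ℂ z) = starRingEnd ℂ (η z)) :
    (∃ μ : Measure ℝ, IsProbabilityMeasure μ ∧ μ (Set.Iio 0) = 0 ∧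
        μ ≠ Measure.dirac 0 ∧ ∀ z ∈ OmegaR, η z = etaR μ z) ↔
      (Tendsto (fun x : ℝ => η (x : ℂ)) (nhdsWithin 0 (Set.Iio 0)) (nhds 0) ∧
        ∀ z : ℂ, 0 < z.im → (η z).arg ∈ Set.Ico z.arg Real.pi) := by
  constructor
  · rintro ⟨μ, hμ1, hμ2, hμ3, hμ4⟩
    have hμ0 : ∀ᵐ s ∂μ, 0 ≤ s := by
      rw [ae_iff]
      have : {s : ℝ | ¬ 0 ≤ s} = Set.Iio 0 := by ext s; simp
      rw [this, hμ2]
    constructor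
    · refine (fwd_lim hμ0).congr' ?_
      filter_upwards [self_mem_nhdsWithin] with x hx
      refine (hμ4 x ?_).symm
      rintro ⟨_, h⟩
      have hx : x < 0 := hx
      simp at h; linarith
    · intro z hz
      rw [hμ4 z (fun h => hz.ne' h.1)]
      obtain ⟨h1, h2⟩ := fwd_arg hμ0 hμ3 hz
      exact im_to_arg hz h1 h2
  · rintro ⟨h1, h2⟩
    exact bwd η hη hne hconj h1 h2
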